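/- arXiv:2308.10749 — 2 statements merged into one kernel-verified Lean document; each statement's English description precedes it below -/
import Mathlib

section
/- For every positive integer r, every positive integer n, every finite set Q ⊆ ℚ₊ and every coloring C : ℚ₊ → {1,…,r}, there exists a vector v ∈ ℚ₊ⁿ such that for every q ∈ Q, the vector q·v is lower-consistent with respect to C; that is, C(φ_𝓘(q·v)) = C(Π_{i∈f(𝓘)} q·v_i) for every n-family 𝓘 with |f(𝓘)| ≤ |I'| for all I' ∈ 𝓘. -/
/-- An `n`-family: a nonempty finite collection of pairwise disjoint nonempty
subsets of `[n] = {1,…,n}`. -/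
def IsNFamily (n : ℕ) (𝓘 : Finset (Finset ℕ)) : Prop :=
  𝓘.Nonempty ∧ (∀ I ∈ 𝓘, I.Nonempty ∧ I ⊆ Finset.Icc 1 n) ∧
    (∀ I ∈ 𝓘, ∀ J ∈ 𝓘, I ≠ J → Disjoint I J)

/-- `L = f(𝓘)`: the member of `𝓘` whose maximum exceeds the maximum of every
other member. -/
def IsLeading (𝓘 : Finset (Finset ℕ)) (L : Finset ℕ) : Prop :=
  L ∈ 𝓘 ∧ ∀ I ∈ 𝓘, I ≠ L → I.max < L.max

/-- `φ_𝓘(v) = Σ_{I ∈ 𝓘} Π_{i ∈ I} v i`. -/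
def phi (𝓘 : Finset (Finset ℕ)) (v : ℕ → ℚ) : ℚ := ∑ I ∈ 𝓘, ∏ i ∈ I, v i

section
open Polynomial

/-- finitary polynomial van der Waerden property for a finite set of polynomials -/
def PVGood {R : Type} [CommRing R] (A : Finset R[X]) : Prop :=
  ∀ (κ : Type) [Finite κ], ∃ (Z : Finset R) (T : Finset ℕ), (∀ t ∈ T, 0 < t) ∧
    ∀ χ : R → κ, ∃ a ∈ Z, ∃ d ∈ T, ∀ p ∈ A, a + p.eval (d : R) ∈ Z ∧ χ (a + p.eval (d : R)) = χ a

/-- the derived polynomial -/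
noncomputable def pvD {R : Type} [CommRing R] (q p : R[X]) (d : ℕ) : R[X] :=
  taylor (d : R) p - C (p.eval (d : R)) - q

noncomputable def pvDer {R : Type} [CommRing R] (A : Finset R[X]) (q : R[X]) (T : Finset ℕ) :
    Finset R[X] := by
  classical exact ((insert 0 T) ×ˢ A).image (fun x => pvD q x.2 x.1)

lemma pvD_eval {R : Type} [CommRing R] (q p : R[X]) (d e : ℕ) :
    (pvD q p d).eval (e : R) = p.eval ((d + e : ℕ) : R) - p.eval (d : R) - q.eval (e : R) := by
  simp [pvD, taylor_eval, add_comm]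

lemma pv_inner {R : Type} [CommRing R] (A : Finset R[X]) (q : R[X])
    (hA0 : ∀ p ∈ A, p.eval 0 = 0)
    (hder : ∀ T : Finset ℕ, (∀ t ∈ T, 0 < t) → PVGood (pvDer A q T)) (κ : Type) [Finite κ] (m : ℕ) :
    ∃ (Z : Finset R) (T : Finset ℕ), (∀ t ∈ T, 0 < t) ∧
    ∀ χ : R → κ, (∃ a ∈ Z, ∃ d ∈ T, ∀ p ∈ A, a + p.eval (d : R) ∈ Z ∧ χ (a + p.eval (d : R)) = χ a) ∨
      (∃ a ∈ Z, ∃ S : Finset κ, S.card = m ∧ ∀ c ∈ S, ∃ d ∈ T, ∀ p ∈ A,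
        a + p.eval (d : R) ∈ Z ∧ χ (a + p.eval (d : R)) = c) := by
  classical
  induction m with
  | zero => exact ⟨{0}, ∅, by simp, fun χ => Or.inr ⟨0, by simp, ∅, by simp, by simp⟩⟩
  | succ m ih =>
    obtain ⟨Z, T, hT, h⟩ := ih
    obtain ⟨Z', T', hT', h'⟩ := hder T hT (Z → κ)
    let g : R × R → R := fun x => x.1 + x.2
    let g2 : R × R × ℕ → R := fun x => x.1 + x.2.1 - q.eval (x.2.2 : R)
    have mem1 : ∀ b ∈ Z', ∀ z ∈ Z, b + z ∈ (Z' ×ˢ Z).image g ∪ (Z' ×ˢ Z ×ˢ T').image g2 := by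
      intro b hb z hz
      exact Finset.mem_union_left _ (Finset.mem_image.2 ⟨(b, z), by simp [hb, hz], rfl⟩)
    have mem2 : ∀ b ∈ Z', ∀ z ∈ Z, ∀ e ∈ T', b + z - q.eval (e : R) ∈
        (Z' ×ˢ Z).image g ∪ (Z' ×ˢ Z ×ˢ T').image g2 := by
      intro b hb z hz e he
      exact Finset.mem_union_right _ (Finset.mem_image.2 ⟨(b, z, e), by simp [hb, hz, he], rfl⟩)
    refine ⟨(Z' ×ˢ Z).image g ∪ (Z' ×ˢ Z ×ˢ T').image g2,
      T ∪ T' ∪ (T ×ˢ T').image (fun x => x.1 + x.2), ?_, ?_⟩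
    · intro t ht
      simp only [Finset.mem_union, Finset.mem_image, Finset.mem_product, Prod.exists] at ht
      rcases ht with (ht | ht) | ⟨u, w, ⟨hu, hw⟩, rfl⟩
      · exact hT _ ht
      · exact hT' _ ht
      · have := hT _ hu; omega
    intro χ
    obtain ⟨b, hb, e, he, hbe⟩ := h' (fun x z => χ (x + z))
    have key : ∀ d ∈ insert 0 T, ∀ p ∈ A, ∀ z ∈ Z,
        b + (pvD q p d).eval (e : R) ∈ Z' ∧ χ (b + (pvD q p d).eval (e : R) + z) = χ (b + z) := by
      intro d hd p hp z hz
      have := hbe (pvD q p d) (by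
        unfold pvDer
        exact Finset.mem_image.2 ⟨(d, p), Finset.mem_product.2 ⟨hd, hp⟩, rfl⟩)
      exact ⟨this.1, congrFun this.2 ⟨z, hz⟩⟩
    rcases h (fun x => χ (b + x)) with ⟨a, ha, d, hd, hmono⟩ | ⟨a, ha, S, hS, hfoc⟩
    · left
      refine ⟨b + a, mem1 _ hb _ ha, d, by simp [hd], fun p hp => ?_⟩
      obtain ⟨h1, h2⟩ := hmono p hp
      rw [add_assoc]
      exact ⟨mem1 _ hb _ h1, h2⟩
    · by_cases hc : χ (b + a) ∈ S
      · left
        obtain ⟨d, hd, hmono⟩ := hfoc _ hc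
        refine ⟨b + a, mem1 _ hb _ ha, d, by simp [hd], fun p hp => ?_⟩
        obtain ⟨h1, h2⟩ := hmono p hp
        rw [add_assoc]
        exact ⟨mem1 _ hb _ h1, h2⟩
      · right
        refine ⟨b + a - q.eval (e : R), mem2 _ hb _ ha _ he, insert (χ (b + a)) S,
          by rw [Finset.card_insert_of_notMem hc, hS], fun c hcS => ?_⟩
        rcases Finset.mem_insert.1 hcS with rfl | hcS
        · refine ⟨e, by simp [he], fun p hp => ?_⟩
          obtain ⟨h1, h2⟩ := key 0 (by simp) p hp a ha
          have e1 : b + a - q.eval (e : R) + p.eval (e : R) =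
              b + (pvD q p 0).eval (e : R) + a := by
            rw [pvD_eval]; simp [hA0 p hp]; ring
          rw [e1]
          exact ⟨mem1 _ h1 _ ha, h2⟩
        · obtain ⟨d, hd, hmono⟩ := hfoc c hcS
          refine ⟨d + e, ?_, fun p hp => ?_⟩
          · apply Finset.mem_union_right
            exact Finset.mem_image.2 ⟨(d, e), by simp [hd, he], rfl⟩
          obtain ⟨h3, h4⟩ := hmono p hp
          obtain ⟨h1, h2⟩ := key d (by simp [hd]) p hp _ h3
          have e1 : b + a - q.eval (e : R) + p.eval ((d + e : ℕ) : R) =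
              b + (pvD q p d).eval (e : R) + (a + p.eval (d : R)) := by
            rw [pvD_eval]; ring
          rw [e1]
          exact ⟨mem1 _ h1 _ h3, h2.trans h4⟩

lemma pv_step {R : Type} [CommRing R] (A : Finset R[X]) (q : R[X])
    (hA0 : ∀ p ∈ A, p.eval 0 = 0)
    (hder : ∀ T : Finset ℕ, (∀ t ∈ T, 0 < t) → PVGood (pvDer A q T)) : PVGood A := by
  intro κ _
  have := Fintype.ofFinite κ
  obtain ⟨Z, T, hT, h⟩ := pv_inner A q hA0 hder κ (Fintype.card κ + 1)
  refine ⟨Z, T, hT, fun χ => ?_⟩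
  rcases h χ with h | ⟨a, _, S, hS, _⟩
  · exact h
  · have := Finset.card_le_univ S
    omega

/-- leading coefficients in degree `k` -/
noncomputable def pvLead {R : Type} [CommRing R] (A : Finset R[X]) (k : ℕ) : Finset R := by
  classical exact (A.filter (fun p => p ≠ 0 ∧ p.natDegree = k)).image leadingCoeff

noncomputable def pvWt {R : Type} [CommRing R] (A : Finset R[X]) : ℕ →₀ ℕ :=
  Finsupp.onFinset (Finset.range (A.sup natDegree + 1)) (fun k => (pvLead A k).card) (by
    classical
    intro k hk
    have : (pvLead A k).Nonempty := Finset.card_pos.1 (Nat.pos_of_ne_zero hk)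
    obtain ⟨c, hc⟩ := this
    unfold pvLead at hc
    simp only [Finset.mem_image, Finset.mem_filter] at hc
    obtain ⟨p, ⟨hp, _, rfl⟩, _⟩ := hc
    have := Finset.le_sup (f := natDegree) hp
    simp only [Finset.mem_range]; omega)

lemma mem_pvLead {R : Type} [CommRing R] (A : Finset R[X]) (k : ℕ) (c : R) :
    c ∈ pvLead A k ↔ ∃ p ∈ A, p ≠ 0 ∧ p.natDegree = k ∧ p.leadingCoeff = c := by
  classical
  simp [pvLead, and_assoc]

lemma mem_pvDer {R : Type} [CommRing R] (A : Finset R[X]) (q : R[X]) (T : Finset ℕ) (P : R[X]) :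
    P ∈ pvDer A q T ↔ ∃ d ∈ insert 0 T, ∃ p ∈ A, pvD q p d = P := by
  classical
  simp only [pvDer, Finset.mem_image, Finset.mem_product, Prod.exists]
  constructor
  · rintro ⟨d, p, ⟨h1, h2⟩, h3⟩; exact ⟨d, h1, p, h2, h3⟩
  · rintro ⟨d, h1, p, h2, h3⟩; exact ⟨d, p, ⟨h1, h2⟩, h3⟩

lemma pvD_coeff_top {R : Type} [CommRing R] (q p : R[X]) (d : ℕ) (hp : 0 < p.natDegree) :
    (pvD q p d).coeff p.natDegree = p.leadingCoeff - q.coeff p.natDegree := by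
  simp [pvD, coeff_C, hp.ne']

lemma pvD_natDegree_le {R : Type} [CommRing R] (q p : R[X]) (d : ℕ)
    (hqp : q.natDegree ≤ p.natDegree) : (pvD q p d).natDegree ≤ p.natDegree := by
  unfold pvD
  refine (natDegree_sub_le_of_le (m := p.natDegree) (n := p.natDegree) ((natDegree_sub_le_of_le (m := p.natDegree) (n := 0) ?_ ?_).trans (by simp)) hqp).trans (by simp)
  · simp
  · simp

lemma pvD_gt {R : Type} [CommRing R] (q p : R[X]) (d : ℕ)
    (hqp : q.natDegree < p.natDegree) :
    (pvD q p d).natDegree = p.natDegree ∧ (pvD q p d).leadingCoeff = p.leadingCoeff := by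
  have h1 : (pvD q p d).coeff p.natDegree = p.leadingCoeff := by
    rw [pvD_coeff_top q p d (by omega), coeff_eq_zero_of_natDegree_lt hqp, sub_zero]
  have h2 : (pvD q p d).natDegree = p.natDegree := by
    apply le_antisymm (pvD_natDegree_le q p d hqp.le)
    apply le_natDegree_of_ne_zero
    rw [h1]
    intro h
    rw [leadingCoeff_eq_zero] at h
    simp [h] at hqp
  exact ⟨h2, by rw [leadingCoeff, h2, h1]⟩

lemma pv_lex {R : Type} [CommRing R] (A : Finset R[X]) (q : R[X]) (T : Finset ℕ)
    (hq : q ∈ A) (hq0 : 0 < q.natDegree) (hmin : ∀ p ∈ A, q.natDegree ≤ p.natDegree) :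
    Finsupp.Lex (· > ·) (· < ·) (pvWt (pvDer A q T)) (pvWt A) := by
  classical
  refine ⟨q.natDegree, fun k hk => ?_, ?_⟩
  · change (pvLead _ k).card = (pvLead _ k).card
    congr 1
    ext c
    rw [mem_pvLead, mem_pvLead]
    constructor
    · rintro ⟨P, hP, hP0, h1, h2⟩
      obtain ⟨d, hd, p, hp, rfl⟩ := (mem_pvDer _ _ _ _).1 hP
      have hlt : q.natDegree < p.natDegree := by
        have := pvD_natDegree_le q p d (hmin p hp)
        omega
      obtain ⟨h3, h4⟩ := pvD_gt q p d hlt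
      exact ⟨p, hp, by rintro rfl; simp at hlt, by omega, by rw [← h4, h2]⟩
    · rintro ⟨p, hp, hp0, h1, h2⟩
      obtain ⟨h3, h4⟩ := pvD_gt q p 0 (by omega)
      exact ⟨_, (mem_pvDer _ _ _ _).2 ⟨0, by simp, p, hp, rfl⟩,
        by rw [← leadingCoeff_ne_zero, h4, leadingCoeff_ne_zero]; exact hp0, by omega, by rw [h4, h2]⟩
  · change (pvLead _ q.natDegree).card < (pvLead _ q.natDegree).card
    have hql : q.leadingCoeff ∈ pvLead A q.natDegree := (mem_pvLead _ _ _).2 ⟨q, hq, by rintro rfl; simp at hq0, rfl, rfl⟩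
    have hsub : pvLead (pvDer A q T) q.natDegree ⊆
        ((pvLead A q.natDegree).erase q.leadingCoeff).image (fun c => c - q.leadingCoeff) := by
      intro c hc
      obtain ⟨P, hP, _, h1, h2⟩ := (mem_pvLead _ _ _).1 hc
      obtain ⟨d, hd, p, hp, rfl⟩ := (mem_pvDer _ _ _ _).1 hP
      have hpq : p.natDegree = q.natDegree := by
        by_contra hne
        have hlt : q.natDegree < p.natDegree := lt_of_le_of_ne (hmin p hp) (Ne.symm hne)
        have := (pvD_gt q p d hlt).1
        omega
      have h3 := pvD_coeff_top q p d (by omega)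
      rw [hpq, ← h1] at h3
      change leadingCoeff _ = _ at h3
      rw [h1] at h3
      change _ = _ - q.leadingCoeff at h3
      rw [h2] at h3
      refine Finset.mem_image.2 ⟨p.leadingCoeff, Finset.mem_erase.2 ⟨fun h => ?_, ?_⟩, h3.symm⟩
      · rw [h, sub_self] at h3
        rw [h3, leadingCoeff_eq_zero] at h2
        rw [h2] at h1
        simp at h1
        omega
      · exact (mem_pvLead _ _ _).2 ⟨p, hp, by rintro rfl; simp at hpq; omega, hpq, rfl⟩
    calc _ ≤ _ := Finset.card_le_card hsub
      _ ≤ _ := Finset.card_image_le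
      _ < _ := Finset.card_erase_lt_of_mem hql

theorem poly_vdw {R : Type} [CommRing R] (A : Finset R[X]) (hA0 : ∀ p ∈ A, p.eval 0 = 0) :
    PVGood A := by
  classical
  have wf : WellFounded (InvImage (Finsupp.Lex (· > ·) (· < ·))
      (fun A : Finset R[X] => pvWt A)) := by
    apply InvImage.wf
    exact Finsupp.Lex.wellFounded' (fun n => by simp) wellFounded_lt wellFounded_lt
  induction A using wf.induction with
  | _ A ih =>
  suffices h : PVGood (A.erase 0) by
    intro κ _
    obtain ⟨Z, T, hT, h⟩ := h κ
    refine ⟨Z, T, hT, fun χ => ?_⟩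
    obtain ⟨a, ha, d, hd, h⟩ := h χ
    refine ⟨a, ha, d, hd, fun p hp => ?_⟩
    by_cases hp0 : p = 0
    · simp [hp0, ha]
    · exact h p (by simp [hp, hp0])
  by_cases hne : (A.erase 0).Nonempty
  · have hdeg : ∀ p ∈ A.erase 0, 0 < p.natDegree := by
      intro p hp
      by_contra h
      have h0 : p.natDegree = 0 := by omega
      have h1 := hA0 p (Finset.mem_of_mem_erase hp)
      rw [eq_C_of_natDegree_eq_zero h0] at h1
      rw [eval_C] at h1
      rw [eq_C_of_natDegree_eq_zero h0, h1] at hp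
      simp at hp
    obtain ⟨q, hq, hmin⟩ := Finset.exists_min_image (A.erase 0) natDegree hne
    apply pv_step (A.erase 0) q (fun p hp => hA0 p (Finset.mem_of_mem_erase hp))
    intro T hT
    apply ih
    · change Finsupp.Lex _ _ _ _
      have h1 := pv_lex (A.erase 0) q T hq (hdeg q hq) hmin
      have h2 : pvWt (A.erase 0) = pvWt A := by
        ext k
        change (pvLead _ k).card = (pvLead _ k).card
        congr 1
        ext c
        rw [mem_pvLead, mem_pvLead]
        constructor
        · rintro ⟨p, hp, h⟩
          exact ⟨p, Finset.mem_of_mem_erase hp, h⟩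
        · rintro ⟨p, hp, h⟩
          exact ⟨p, Finset.mem_erase.2 ⟨h.1, hp⟩, h⟩
      rw [h2] at h1
      exact h1
    · intro P hP
      obtain ⟨d, hd, p, hp, rfl⟩ := (mem_pvDer _ _ _ _).1 hP
      have := pvD_eval q p d 0
      simp at this
      rw [this, hA0 q (Finset.mem_of_mem_erase hq)]
      simp
  · rw [Finset.not_nonempty_iff_eq_empty] at hne
    rw [hne]
    intro κ _
    exact ⟨{0}, {1}, by simp, fun χ => ⟨0, by simp, 1, by simp, by simp⟩⟩

lemma multi_vdw (B : Type) [Fintype B] (deg : B → ℕ) (K : ℕ) :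
    ∀ (κ : Type) [Finite κ] (P : Finset (B → ℚ)), ∃ T : Finset ℕ, (∀ t ∈ T, 0 < t) ∧
      ∀ (C : ℚ → κ) (e : B → ℚ) (M : ℚ), ∃ t ∈ T, ∃ x : ℚ, M ≤ x ∧ ∀ k < K, ∀ p ∈ P,
        C ((t : ℚ) ^ k * (x + ∑ b, p b * ((t : ℚ) ^ (deg b + 1) * e b))) = C ((t : ℚ) ^ k * x) := by
  classical
  induction K with
  | zero =>
    intro κ _ P
    exact ⟨{1}, by simp, fun C e M => ⟨1, by simp, M, le_rfl, by simp⟩⟩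
  | succ K ih =>
    intro κ _ P
    let poly : (B → ℚ) → (B → ℚ)[X] := fun p =>
      ∑ b, Polynomial.C (Pi.single b (p b)) * X ^ (deg b + 1 + K)
    have hpoly : ∀ p (s : ℕ) (b : B), (poly p).eval (s : B → ℚ) b = p b * (s : ℚ) ^ (deg b + 1 + K) := by
      intro p s b
      simp only [poly, eval_finsetSum, eval_mul, eval_C, eval_pow, eval_X, Finset.sum_apply,
        Pi.mul_apply, Pi.pow_apply, Pi.natCast_apply]
      rw [Finset.sum_eq_single b]
      · simp
      · intro c _ hc
        simp [Pi.single_eq_of_ne hc.symm]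
      · simp
    obtain ⟨Z, Ts, hTs, hpv⟩ := poly_vdw (P.image poly) (by
      intro q hq
      obtain ⟨p, hp, rfl⟩ := Finset.mem_image.1 hq
      ext b
      have := hpoly p 0 b
      simpa using this) κ
    obtain ⟨T, hT, h⟩ := ih (Ts × Fin (K + 1) → κ) Z
    refine ⟨(T ×ˢ Ts).image (fun x => x.1 * x.2), ?_, ?_⟩
    · intro t ht
      obtain ⟨x, hx, rfl⟩ := Finset.mem_image.1 ht
      rw [Finset.mem_product] at hx
      exact Nat.mul_pos (hT _ hx.1) (hTs _ hx.2)
    intro C e M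
    obtain ⟨M', hM'⟩ := Finset.exists_le ((T ×ˢ Z ×ˢ Ts).image (fun x : ℕ × (B → ℚ) × ℕ =>
      M * (x.2.2 : ℚ) ^ K - ∑ b, x.2.1 b * ((x.1 : ℚ) ^ (deg b + 1) * e b)))
    obtain ⟨D, hD, y, hy, hDy⟩ := h (fun u sk => C (u / (sk.1.1 : ℚ) ^ sk.2.1)) e M'
    obtain ⟨w, hw, s, hs, hws⟩ := hpv (fun w => C ((D : ℚ) ^ K *
      (y + ∑ b, w b * ((D : ℚ) ^ (deg b + 1) * e b))))
    have hs0 : (s : ℚ) ≠ 0 := by have := hTs s hs; positivity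
    refine ⟨D * s, Finset.mem_image.2 ⟨(D, s), by simp [hD, hs], rfl⟩,
      (y + ∑ b, w b * ((D : ℚ) ^ (deg b + 1) * e b)) / (s : ℚ) ^ K, ?_, ?_⟩
    · rw [le_div_iff₀ (by have := hTs s hs; positivity)]
      have := hM' _ (Finset.mem_image.2 ⟨(D, w, s), by simp [hD, hs, hw], rfl⟩)
      simp only at this
      linarith
    intro k hk p hp
    obtain ⟨hw1, hw2⟩ := hws _ (Finset.mem_image_of_mem poly hp)
    have hk' : k ≤ K := by omega
    have hsplit : (s : ℚ) ^ K = (s : ℚ) ^ k * (s : ℚ) ^ (K - k) := by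
      rw [← pow_add]; congr 1; omega
    have ex : ((D * s : ℕ) : ℚ) ^ k * ((y + ∑ b, w b * ((D : ℚ) ^ (deg b + 1) * e b)) / (s : ℚ) ^ K)
        = (D : ℚ) ^ k * (y + ∑ b, w b * ((D : ℚ) ^ (deg b + 1) * e b)) / (s : ℚ) ^ (K - k) := by
      rw [hsplit]; push_cast; field_simp; ring
    have ex2 : ((D * s : ℕ) : ℚ) ^ k * ((y + ∑ b, w b * ((D : ℚ) ^ (deg b + 1) * e b)) / (s : ℚ) ^ K
          + ∑ b, p b * (((D * s : ℕ) : ℚ) ^ (deg b + 1) * e b))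
        = (D : ℚ) ^ k * (y + ∑ b, (w + (poly p).eval (s : B → ℚ)) b * ((D : ℚ) ^ (deg b + 1) * e b))
          / (s : ℚ) ^ (K - k) := by
      have e1 : ∑ b, (w + (poly p).eval (s : B → ℚ)) b * ((D : ℚ) ^ (deg b + 1) * e b) =
          ∑ b, w b * ((D : ℚ) ^ (deg b + 1) * e b) + (s : ℚ) ^ K *
          ∑ b, p b * (((D * s : ℕ) : ℚ) ^ (deg b + 1) * e b) := by
        rw [Finset.mul_sum, ← Finset.sum_add_distrib]
        refine Finset.sum_congr rfl fun b _ => ?_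
        rw [Pi.add_apply, hpoly]
        push_cast
        ring
      rw [mul_add, ex, e1, hsplit]
      push_cast
      field_simp
      ring
    rw [ex, ex2]
    rcases Nat.lt_or_eq_of_le hk' with hlt | rfl
    · have h1 := congrFun (hDy k hlt _ hw1) (⟨s, hs⟩, ⟨K - k, by omega⟩)
      have h2 := congrFun (hDy k hlt _ hw) (⟨s, hs⟩, ⟨K - k, by omega⟩)
      exact h1.trans h2.symm
    · simpa using hw2

end

lemma dilates_step (r n : ℕ) (C : ℚ → Fin r)
    (ih : ∀ Q : Finset ℚ, (∀ q ∈ Q, 0 < q) →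
      ∃ v : ℕ → ℚ, (∀ i ∈ Finset.Icc 1 n, 0 < v i) ∧
      ∀ q ∈ Q, ∀ 𝓘 : Finset (Finset ℕ), IsNFamily n 𝓘 →
        ∀ F : Finset ℕ, IsLeading 𝓘 F →
          (∀ I' ∈ 𝓘, F.card ≤ I'.card) →
          C (phi 𝓘 (fun i => q * v i)) = C (∏ i ∈ F, q * v i))
    (Q : Finset ℚ) (hQ : ∀ q ∈ Q, 0 < q) :
    ∃ v : ℕ → ℚ, (∀ i ∈ Finset.Icc 1 (n + 1), 0 < v i) ∧
      ∀ q ∈ Q, ∀ 𝓘 : Finset (Finset ℕ), IsNFamily (n + 1) 𝓘 →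
        ∀ F : Finset ℕ, IsLeading 𝓘 F →
          (∀ I' ∈ 𝓘, F.card ≤ I'.card) →
          C (phi 𝓘 (fun i => q * v i)) = C (∏ i ∈ F, q * v i) := by
  classical
  let ι := Q × (Finset.Icc 1 n).powerset
  let B := ι × (Finset.Icc 1 n).powerset
  let deg : B → ℕ := fun b => b.2.1.card - (b.1.2.1.card + 1)
  obtain ⟨T, hT, hmv⟩ := multi_vdw B deg (n + 1) (ι → Fin r)
    (Finset.univ.image (fun S : Finset B => fun b => if b ∈ S then (1 : ℚ) else 0))
  obtain ⟨v, hv, hcons⟩ := ih ((Q ×ˢ T).image (fun x => x.1 * (x.2 : ℚ))) (by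
    intro q hq
    obtain ⟨x, hx, rfl⟩ := Finset.mem_image.1 hq
    rw [Finset.mem_product] at hx
    have := hQ _ hx.1
    have := hT _ hx.2
    positivity)
  obtain ⟨t, ht, x, hx, hC⟩ := hmv
    (fun u a => C ((a.1.1 ^ (a.2.1.card + 1) * ∏ i ∈ a.2.1, v i) * u))
    (fun b => b.1.1.1 ^ (b.2.1.card - (b.1.2.1.card + 1)) * (∏ i ∈ b.2.1, v i) /
      ∏ i ∈ b.1.2.1, v i) 1
  have ht0 : (0 : ℚ) < t := by have := hT t ht; positivity
  let v' : ℕ → ℚ := fun i => if i = n + 1 then x else t * v i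
  have hv'1 : v' (n + 1) = x := by simp [v']
  have hv'2 : ∀ i, i ≠ n + 1 → v' i = t * v i := fun i hi => by simp [v', hi]
  refine ⟨v', ?_, ?_⟩
  · intro i hi
    by_cases h : i = n + 1
    · rw [h, hv'1]; linarith
    · rw [hv'2 i h]
      have := hv i (by simp only [Finset.mem_Icc] at hi ⊢; omega)
      positivity
  intro q hq 𝓘 h𝓘 F hF hcard
  obtain ⟨hne, hsub, hdisj⟩ := h𝓘
  have hprod : ∀ I : Finset ℕ, n + 1 ∉ I →
      ∏ i ∈ I, q * v' i = q ^ I.card * (t : ℚ) ^ I.card * ∏ i ∈ I, v i := by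
    intro I hI
    rw [← mul_pow, ← Finset.prod_const, ← Finset.prod_mul_distrib]
    refine Finset.prod_congr rfl fun i hi => ?_
    rw [hv'2 i (fun h => hI (h ▸ hi))]
    ring
  have hsub' : ∀ I ∈ 𝓘, n + 1 ∉ I → I ⊆ Finset.Icc 1 n := by
    intro I hI hnI i hi
    have h1 := (hsub I hI).2 hi
    have h2 : i ≠ n + 1 := fun h => hnI (h ▸ hi)
    simp only [Finset.mem_Icc] at h1 ⊢
    omega
  by_cases hnF : n + 1 ∈ F
  · -- main case
    have hnI : ∀ I ∈ 𝓘.erase F, n + 1 ∉ I := by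
      intro I hI h
      exact Finset.disjoint_left.1 (hdisj I (Finset.mem_of_mem_erase hI) F hF.1
        (Finset.ne_of_mem_erase hI)) h hnF
    have hF'sub : F.erase (n + 1) ⊆ Finset.Icc 1 n := by
      intro i hi
      have h1 := (hsub F hF.1).2 (Finset.mem_of_mem_erase hi)
      have h2 := Finset.ne_of_mem_erase hi
      simp only [Finset.mem_Icc] at h1 ⊢
      omega
    have hFcard : F.card = (F.erase (n + 1)).card + 1 := (Finset.card_erase_add_one hnF).symm
    have hF'le : (F.erase (n + 1)).card < n + 1 := by
      have := Finset.card_le_card hF'sub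
      simp at this
      simp
      omega
    generalize hF' : F.erase (n + 1) = F' at *
    have hFprod : ∏ i ∈ F, q * v' i =
        (q ^ (F'.card + 1) * ∏ i ∈ F', v i) * ((t : ℚ) ^ F'.card * x) := by
      rw [← Finset.mul_prod_erase F _ hnF, hF', hprod F' (by rw [← hF']; simp), hv'1]
      ring
    let a : ι := (⟨q, hq⟩, ⟨F', Finset.mem_powerset.2 hF'sub⟩)
    let S : Finset B := Finset.univ.filter (fun b => b.1 = a ∧ b.2.1 ∈ 𝓘.erase F)
    have key := congrFun (hC F'.card hF'le _ (Finset.mem_image_of_mem _ (Finset.mem_univ S))) a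
    simp only [a] at key
    rw [hFprod, ← key]
    congr 1
    rw [phi, ← Finset.add_sum_erase 𝓘 _ hF.1, hFprod, mul_add, mul_add]
    congr 1
    simp only [ite_mul, one_mul, zero_mul]
    rw [← Finset.sum_filter, Finset.mul_sum, Finset.mul_sum]
    have hvF : ∏ i ∈ F', v i ≠ 0 := (Finset.prod_pos fun i hi => hv i (hF'sub hi)).ne'
    refine Finset.sum_bij (fun I hI => (a, ⟨I, Finset.mem_powerset.2
      (hsub' I (Finset.mem_of_mem_erase hI) (hnI I hI))⟩)) ?_ ?_ ?_ ?_
    · intro I hI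
      simp only [S, Finset.mem_filter, Finset.mem_univ, true_and]
      exact hI
    · intro I hI J hJ h
      exact congrArg (fun b : B => b.2.1) h
    · rintro ⟨b1, b2⟩ hb
      simp only [S, Finset.mem_filter, Finset.mem_univ, true_and] at hb
      obtain ⟨h1, h2⟩ := hb
      refine ⟨b2.1, h2, ?_⟩
      rw [h1]
    · intro I hI
      rw [hprod I (hnI I hI)]
      have hc := hcard I (Finset.mem_of_mem_erase hI)
      rw [hFcard] at hc
      obtain ⟨m, hm⟩ := Nat.exists_eq_add_of_le hc
      simp only [deg, a]
      rw [hm, Nat.add_sub_cancel_left]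
      field_simp
      ring
  · have hall : ∀ I ∈ 𝓘, n + 1 ∉ I := by
      intro I hI h
      by_cases hIF : I = F
      · exact hnF (hIF ▸ h)
      · have h1 := hF.2 I hI hIF
        have h2 := Finset.le_max h
        have h3 : F.max ≤ ((n + 1 : ℕ) : WithBot ℕ) := by
          apply Finset.max_le
          intro i hi
          have := (hsub F hF.1).2 hi
          simp only [Finset.mem_Icc] at this
          exact WithBot.coe_le_coe.2 this.2
        exact absurd (h2.trans_lt h1) (not_lt.2 h3)
    have hc := hcons (q * t) (Finset.mem_image.2 ⟨(q, t), by simp [hq, ht], rfl⟩) 𝓘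
      ⟨hne, fun I hI => ⟨(hsub I hI).1, hsub' I hI (hall I hI)⟩, hdisj⟩ F hF hcard
    have hcongr : ∀ I ∈ 𝓘, ∏ i ∈ I, q * v' i = ∏ i ∈ I, q * t * v i := by
      intro I hI
      refine Finset.prod_congr rfl fun i hi => ?_
      rw [hv'2 i (fun h => hall I hI (h ▸ hi)), mul_assoc]
    rw [phi, Finset.sum_congr rfl hcongr, hcongr F hF.1]
    exact hc

/-- For every positive integer `r`, every positive integer `n`, every finite set
`Q` of positive rationals, and every `r`-coloring `C` of the positive rationals,
there is a vector `v` of positive rationals such that for every `q ∈ Q` the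
vector `q·v` is lower-consistent: `C(φ_𝓘(q·v)) = C(Π_{i ∈ f(𝓘)} q·v i)` for
every `n`-family `𝓘` with `|f(𝓘)| ≤ |I'|` for all `I' ∈ 𝓘`. -/
theorem dilates_lower_consistent (r n : ℕ) (hr : 0 < r) (hn : 0 < n)
    (Q : Finset ℚ) (hQ : ∀ q ∈ Q, 0 < q) (C : ℚ → Fin r) :
    ∃ v : ℕ → ℚ, (∀ i ∈ Finset.Icc 1 n, 0 < v i) ∧
      ∀ q ∈ Q, ∀ 𝓘 : Finset (Finset ℕ), IsNFamily n 𝓘 →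
        ∀ F : Finset ℕ, IsLeading 𝓘 F →
          (∀ I' ∈ 𝓘, F.card ≤ I'.card) →
          C (phi 𝓘 (fun i => q * v i)) = C (∏ i ∈ F, q * v i) := by
  clear hr hn
  induction n generalizing Q with
  | zero =>
    refine ⟨fun _ => 1, by simp, fun q hq 𝓘 h𝓘 F hF _ => ?_⟩
    obtain ⟨h1, h2⟩ := h𝓘.2.1 F hF.1
    obtain ⟨i, hi⟩ := h1
    simpa using h2 hi
  | succ n ih => exact dilates_step r n C (fun Q hQ => ih Q hQ) Q hQ
end

section
/- Let 𝔛 be a collection of new n-families such that |A| > |B| for every (A,B) ∈ newp(𝔛), and write Ω := newp(𝔛). Then for every positive integer r and every finite set Ξ ⊆ ℚ_{≥0}^Ω, there exist finite sets D ⊆ ℕ and Δ ⊆ ℕ^Ω such that: for every u ∈ ℚ₊^{n−1}, every x ∈ ℚ₊ and every coloring C : ℚ₊ → {1,…,r}, there exist d ∈ D and δ ∈ Δ such that, setting x' := x + Σ_{(A,B)∈Ω} δ_{(A,B)}·(Π_{a∈A} u_a)/(Π_{b∈B} u_b) and u' := (d·u₁,…,d·u_{n−1}), one has C(x' + Σ_{(A,B)∈Ω}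 ξ_{(A,B)}·(Π_{a∈A} u'_a)/(Π_{b∈B} u'_b)) = C(x') for every ξ ∈ Ξ. -/
/-- The ratio `(Π_{a ∈ A} u a) / (Π_{b ∈ B} u b)` associated to a pair `(A, B)`. -/
def ratio (u : ℕ → ℚ) (AB : Finset ℕ × Finset ℕ) : ℚ :=
  (∏ a ∈ AB.1, u a) / (∏ b ∈ AB.2, u b)

/-- `newp(𝔛)`: the pairs `(A, B)` of subsets of `[n-1]` such that `A` and
`B ∪ {n}` are distinct members of a common family `𝓘 ∈ 𝔛`. -/
def newp (n : ℕ) (𝔛 : Set (Finset (Finset ℕ))) : Set (Finset ℕ × Finset ℕ) :=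
  {AB | AB.1 ⊆ Finset.Icc 1 (n - 1) ∧ AB.2 ⊆ Finset.Icc 1 (n - 1) ∧
    ∃ 𝓘 ∈ 𝔛, AB.1 ∈ 𝓘 ∧ AB.2 ∪ {n} ∈ 𝓘 ∧ AB.1 ≠ AB.2 ∪ {n}}

open scoped Classical in
/-- `newp(𝔛)` as a finite set (it consists of pairs of subsets of `[n-1]`). -/
noncomputable def newpF (n : ℕ) (𝔛 : Set (Finset (Finset ℕ))) :
    Finset (Finset ℕ × Finset ℕ) :=
  ((Finset.Icc 1 (n - 1)).powerset ×ˢ (Finset.Icc 1 (n - 1)).powerset).filter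
    (fun AB => AB ∈ newp n 𝔛)

section PolyVdW

/-- Polynomial maps vanishing at zero of degree at most `m`. -/
def IsPM {G : Type} [AddCommGroup G] : ℕ → (ℕ → G) → Prop
  | 0, p => p = 0
  | m + 1, p => p 0 = 0 ∧ ∀ h, IsPM m (fun n => p (n + h) - p h - p n)

theorem IsPM.zero {G : Type} [AddCommGroup G] (m : ℕ) : IsPM m (0 : ℕ → G) := by
  induction m with
  | zero => rfl
  | succ m ih =>
    refine ⟨rfl, fun h => ?_⟩
    have : (fun n => (0 : ℕ → G) (n + h) - (0 : ℕ → G) h - (0 : ℕ → G) n) = 0 := by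
      funext n; simp
    rw [this]; exact ih

theorem IsPM.add {G : Type} [AddCommGroup G] {m : ℕ} : ∀ {p q : ℕ → G},
    IsPM m p → IsPM m q → IsPM m (p + q) := by
  induction m with
  | zero => intro p q hp hq; simp only [IsPM] at *; simp [hp, hq]
  | succ m ih =>
    rintro p q ⟨hp0, hp⟩ ⟨hq0, hq⟩
    refine ⟨by simp [hp0, hq0], fun h => ?_⟩
    have := ih (hp h) (hq h)
    convert this using 1
    funext n; simp only [Pi.add_apply]; abel

theorem IsPM.neg {G : Type} [AddCommGroup G] {m : ℕ} : ∀ {p : ℕ → G},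
    IsPM m p → IsPM m (-p) := by
  induction m with
  | zero => intro p hp; simp only [IsPM] at *; simp [hp]
  | succ m ih =>
    rintro p ⟨hp0, hp⟩
    refine ⟨by simp [hp0], fun h => ?_⟩
    have := ih (hp h)
    convert this using 1
    funext n; simp only [Pi.neg_apply]; abel

theorem IsPM.sub {G : Type} [AddCommGroup G] {m : ℕ} {p q : ℕ → G}
    (hp : IsPM m p) (hq : IsPM m q) : IsPM m (p - q) := by
  rw [sub_eq_add_neg]; exact hp.add hq.neg

theorem IsPM.succ {G : Type} [AddCommGroup G] {m : ℕ} : ∀ {p : ℕ → G},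
    IsPM m p → IsPM (m + 1) p := by
  induction m with
  | zero => intro p hp; simp only [IsPM] at hp; rw [hp]; exact IsPM.zero 1
  | succ m ih =>
    rintro p ⟨hp0, hp⟩
    exact ⟨hp0, fun h => ih (hp h)⟩

theorem IsPM.mono {G : Type} [AddCommGroup G] {m l : ℕ} (hml : m ≤ l) {p : ℕ → G}
    (hp : IsPM m p) : IsPM l p := by
  induction hml with
  | refl => exact hp
  | step _ ih => exact ih.succ

theorem IsPM.at_zero {G : Type} [AddCommGroup G] {m : ℕ} {p : ℕ → G}
    (hp : IsPM m p) : p 0 = 0 := hp.succ.1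

theorem IsPM.pi {I : Type} {m : ℕ} : ∀ {p : ℕ → I → ℤ},
    (∀ i, IsPM m (fun n => p n i)) → IsPM m p := by
  induction m with
  | zero =>
    intro p hp
    simp only [IsPM] at *
    funext n i
    exact congrFun (hp i) n
  | succ m ih =>
    intro p hp
    refine ⟨funext fun i => (hp i).1, fun h => ih fun i => (hp i).2 h⟩

theorem IsPM.sum {I : Type} {G : Type} [AddCommGroup G] {m : ℕ} (s : Finset I) (f : I → ℕ → G)
    (hf : ∀ i ∈ s, IsPM m (f i)) : IsPM m (∑ i ∈ s, f i) :=
  Finset.sum_induction f (IsPM m) (fun _ _ => IsPM.add) (IsPM.zero m) hf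

theorem IsPM.monomial (e : ℕ) : ∀ c : ℤ, IsPM (e + 1) (fun n : ℕ => c * (n : ℤ) ^ (e + 1)) := by
  induction e using Nat.strong_induction_on with
  | _ e ih =>
    intro c
    refine ⟨by simp, fun h => ?_⟩
    have key : (fun n : ℕ => c * ((n + h : ℕ) : ℤ) ^ (e + 1) - c * (h : ℤ) ^ (e + 1)
        - c * (n : ℤ) ^ (e + 1)) =
        ∑ j ∈ Finset.range e, fun n : ℕ =>
          (c * (h : ℤ) ^ (e - j) * ((e + 1).choose (j + 1) : ℤ)) * (n : ℤ) ^ (j + 1) := by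
      funext n
      rw [Finset.sum_apply]
      push_cast
      rw [add_pow, Finset.sum_range_succ, Finset.sum_range_succ']
      simp only [mul_add, Finset.mul_sum, Nat.choose_self, Nat.choose_zero_right, Nat.sub_self,
        Nat.sub_zero, pow_zero, Nat.cast_one, mul_one, one_mul, Nat.reduceSubDiff]
      have : ∀ a b d : ℤ, a + b + d - b - d = a := fun a b d => by ring
      rw [this]
      refine Finset.sum_congr rfl fun j _ => ?_
      ring
    rw [key]
    refine IsPM.sum _ _ fun j hj => ?_
    have hjlt := Finset.mem_range.1 hj
    exact (ih j hjlt _).mono hjlt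

/-- The polynomial van der Waerden property for a finite system. -/
def PGood {G : Type} [AddCommGroup G] (A : Finset (ℕ → G)) : Prop :=
  ∀ (κ : Type) [Fintype κ], ∃ (S : Finset G) (D : Finset ℕ), (∀ d ∈ D, 0 < d) ∧
    ∀ C : G → κ, ∃ a ∈ S, ∃ d ∈ D, ∀ p ∈ A, C (a + p d) = C a

open scoped Classical in
theorem focus_step {G : Type} [AddCommGroup G] (A : Finset (ℕ → G)) (hA0 : ∀ p ∈ A, p 0 = 0)
    (q : ℕ → G)
    (hgood : ∀ H : Finset ℕ, PGood ((A ×ˢ H).image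
      (fun ph => fun n => ph.1 (n + ph.2) - ph.1 ph.2 - q n)))
    (κ : Type) [Fintype κ] (s : ℕ) :
    ∃ (S : Finset G) (D : Finset ℕ), (∀ d ∈ D, 0 < d) ∧
    ∀ C : G → κ, (∃ a ∈ S, ∃ d ∈ D, ∀ p ∈ A, C (a + p d) = C a) ∨
      (∃ a ∈ S, ∃ f : Finset κ, f.card = s ∧ ∀ c ∈ f, ∃ d ∈ D, ∀ p ∈ A, C (a + p d) = c) := by
  induction s with
  | zero =>
    refine ⟨{0}, ∅, by simp, fun C => Or.inr ⟨0, by simp, ∅, by simp, by simp⟩⟩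
  | succ s ih =>
    obtain ⟨S, D, hD, hS⟩ := ih
    let T : Finset G := S ∪ ((S ×ˢ (A ×ˢ D)).image (fun x => x.1 + x.2.1 x.2.2))
    obtain ⟨S', D', hD', hS'⟩ := hgood (insert 0 D) (T → κ)
    refine ⟨(S' ×ˢ S).image (fun x => x.1 + x.2) ∪
      (S' ×ˢ (S ×ˢ D')).image (fun x => x.1 + x.2.1 - q x.2.2),
      D ∪ D' ∪ (D ×ˢ D').image (fun x => x.1 + x.2), ?_, ?_⟩
    · intro d hd
      simp only [Finset.mem_union, Finset.mem_image, Finset.mem_product, Prod.exists] at hd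
      rcases hd with (hd | hd) | ⟨a, b, ⟨ha, hb⟩, rfl⟩
      · exact hD d hd
      · exact hD' d hd
      · have := hD a ha; omega
    · intro C
      obtain ⟨a', ha', d', hd', hmono⟩ := hS' (fun g t => C (g + t))
      have hm : ∀ p ∈ A, ∀ h ∈ insert 0 D, ∀ t ∈ T,
          C (a' + (p (d' + h) - p h - q d') + t) = C (a' + t) := by
        intro p hp h hh t ht
        have := hmono (fun n => p (n + h) - p h - q n)
          (Finset.mem_image.2 ⟨(p, h), Finset.mem_product.2 ⟨hp, hh⟩, rfl⟩)
        exact congrFun this ⟨t, ht⟩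
      have hmonocase : ∀ a ∈ S, ∀ d ∈ D, (∀ p ∈ A, C (a' + (a + p d)) = C (a' + a)) →
          (∃ a ∈ (S' ×ˢ S).image (fun x => x.1 + x.2) ∪
            (S' ×ˢ (S ×ˢ D')).image (fun x => x.1 + x.2.1 - q x.2.2),
          ∃ d ∈ D ∪ D' ∪ (D ×ˢ D').image (fun x => x.1 + x.2), ∀ p ∈ A, C (a + p d) = C a) := by
        intro a ha d hd h
        refine ⟨a' + a, Finset.mem_union_left _ (Finset.mem_image.2
          ⟨(a', a), Finset.mem_product.2 ⟨ha', ha⟩, rfl⟩), d,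
          Finset.mem_union_left _ (Finset.mem_union_left _ hd), fun p hp => ?_⟩
        rw [add_assoc]; exact h p hp
      rcases hS (fun t => C (a' + t)) with ⟨a, ha, d, hd, h⟩ | ⟨a, ha, f, hf, h⟩
      · exact Or.inl (hmonocase a ha d hd h)
      · by_cases hc : C (a' + a) ∈ f
        · obtain ⟨d, hd, h⟩ := h _ hc
          exact Or.inl (hmonocase a ha d hd h)
        · right
          refine ⟨a' + a - q d', Finset.mem_union_right _ (Finset.mem_image.2
            ⟨(a', a, d'), by simp [ha', ha, hd'], rfl⟩), insert (C (a' + a)) f, ?_, ?_⟩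
          · rw [Finset.card_insert_of_notMem hc, hf]
          · intro c hcf
            rcases Finset.mem_insert.1 hcf with rfl | hcf
            · refine ⟨d', Finset.mem_union_left _ (Finset.mem_union_right _ hd'), fun p hp => ?_⟩
              rw [← hm p hp 0 (by simp) a (Finset.mem_union_left _ ha), hA0 p hp]
              congr 1
              simp only [add_zero]; abel
            · obtain ⟨d, hd, h⟩ := h c hcf
              refine ⟨d + d', Finset.mem_union_right _ (Finset.mem_image.2
                ⟨(d, d'), Finset.mem_product.2 ⟨hd, hd'⟩, rfl⟩), fun p hp => ?_⟩
              rw [← h p hp, ← hm p hp d (by simp [hd]) (a + p d)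
                (Finset.mem_union_right _ (Finset.mem_image.2
                ⟨(a, p, d), by simp [ha, hp, hd], rfl⟩))]
              congr 1
              rw [add_comm d d']; abel

open scoped Classical in
theorem good_step {G : Type} [AddCommGroup G] (A : Finset (ℕ → G)) (hA0 : ∀ p ∈ A, p 0 = 0)
    (q : ℕ → G)
    (hgood : ∀ H : Finset ℕ, PGood ((A ×ˢ H).image
      (fun ph => fun n => ph.1 (n + ph.2) - ph.1 ph.2 - q n))) : PGood A := by
  intro κ _
  obtain ⟨S, D, hD, h⟩ := focus_step A hA0 q hgood κ (Fintype.card κ + 1)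
  refine ⟨S, D, hD, fun C => (h C).resolve_right ?_⟩
  rintro ⟨a, _, f, hf, _⟩
  have := Finset.card_le_univ f
  omega

open scoped Classical in
theorem good_erase {G : Type} [AddCommGroup G] (A : Finset (ℕ → G)) (h : PGood (A.erase 0)) :
    PGood A := by
  intro κ _
  obtain ⟨S, D, hD, h⟩ := h κ
  refine ⟨S, D, hD, fun C => ?_⟩
  obtain ⟨a, ha, d, hd, h⟩ := h C
  refine ⟨a, ha, d, hd, fun p hp => ?_⟩
  by_cases hp0 : p = 0
  · simp [hp0]
  · exact h p (Finset.mem_erase.2 ⟨hp0, hp⟩)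

/-- `M` is a list of classes covering the nonzero members of `A`. -/
def Covers {G : Type} [AddCommGroup G] (M : Multiset (ℕ × (ℕ → G))) (A : Finset (ℕ → G)) : Prop :=
  (∀ x ∈ M, IsPM (x.1 + 1) x.2) ∧ ∀ p ∈ A, p = 0 ∨ ∃ x ∈ M, IsPM x.1 (p - x.2)

open scoped Classical in
theorem good_of_covers {G : Type} [AddCommGroup G] (s : Multiset ℕ) :
    ∀ (M : Multiset (ℕ × (ℕ → G))) (A : Finset (ℕ → G)), M.map Prod.fst = s → Covers M A →
      PGood A := by
  have wf : WellFounded (Relation.CutExpand (fun a b : ℕ => a < b)) :=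
    WellFounded.cutExpand Nat.lt_wfRel.wf
  induction s using wf.induction with
  | _ s ih =>
  intro M A hM hcov
  apply good_erase
  by_cases hM0 : M = 0
  · intro κ _
    refine ⟨{0}, {1}, by simp, fun C => ⟨0, by simp, 1, by simp, fun p hp => ?_⟩⟩
    obtain ⟨hp0, hp⟩ := Finset.mem_erase.1 hp
    rcases hcov.2 p hp with h | ⟨x, hx, _⟩
    · exact absurd h hp0
    · simp [hM0] at hx
  · have hne : M.toFinset.Nonempty := by
      rw [Finset.nonempty_iff_ne_empty]; simpa using hM0
    obtain ⟨x, hx, hmin⟩ := Finset.exists_min_image M.toFinset Prod.fst hne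
    obtain ⟨k, q⟩ := x
    simp only [Multiset.mem_toFinset] at hx hmin
    obtain ⟨M', rfl⟩ := Multiset.exists_cons_of_mem hx
    have hq : IsPM (k + 1) q := hcov.1 _ hx
    have hA : ∀ p ∈ A.erase 0, ∃ x ∈ (k, q) ::ₘ M', IsPM x.1 (p - x.2) := by
      intro p hp
      obtain ⟨hp0, hp⟩ := Finset.mem_erase.1 hp
      exact (hcov.2 p hp).resolve_left hp0
    have hpoly : ∀ p, ∀ x ∈ (k, q) ::ₘ M', IsPM x.1 (p - x.2) → IsPM (x.1 + 1) p := by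
      intro p x hx h
      have := h.succ.add (hcov.1 x hx)
      simpa using this
    refine good_step _ (fun p hp => ?_) q fun H => ?_
    · obtain ⟨x, hx, h⟩ := hA p hp
      exact (hpoly p x hx h).at_zero
    · set A' := ((A.erase 0) ×ˢ H).image
        (fun ph => fun n => ph.1 (n + ph.2) - ph.1 ph.2 - q n) with hA'
      let N : Multiset (ℕ × (ℕ → G)) :=
        if k = 0 then 0 else (A'.filter (fun g => IsPM k g)).val.map (fun g => (k - 1, g))
      have hN : ∀ x ∈ N, k ≠ 0 ∧ x.1 = k - 1 ∧ IsPM k x.2 := by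
        intro x hx
        by_cases hk : k = 0
        · simp [N, hk] at hx
        · simp only [N, hk, if_false, Multiset.mem_map] at hx
          obtain ⟨g, hg, rfl⟩ := hx
          exact ⟨hk, rfl, (Finset.mem_filter.1 hg).2⟩
      let M'' := M'.map (fun x => (x.1, x.2 - q)) + N
      refine ih (M''.map Prod.fst) ?_ M'' A' rfl ⟨?_, ?_⟩
      · refine ⟨N.map Prod.fst, k, ?_, ?_⟩
        · intro a ha
          obtain ⟨x, hx, rfl⟩ := Multiset.mem_map.1 ha
          obtain ⟨h1, h2, _⟩ := hN x hx
          omega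
        · rw [← hM]
          simp only [M'', Multiset.map_add, Multiset.map_map, Multiset.map_cons,
            Function.comp_def]
          rw [← Multiset.singleton_add]
          abel
      · intro x hx
        rcases Multiset.mem_add.1 hx with hx | hx
        · obtain ⟨y, hy, rfl⟩ := Multiset.mem_map.1 hx
          have hy' : y ∈ (k, q) ::ₘ M' := Multiset.mem_cons_of_mem hy
          have := hmin y hy'
          exact (hcov.1 y hy').sub (hq.mono (by simpa using this))
        · obtain ⟨h1, h2, h3⟩ := hN x hx
          rw [h2]
          exact h3.mono (by omega)
      · intro g hg
        obtain ⟨⟨p, h⟩, hph, hgdef⟩ := Finset.mem_image.1 hg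
        obtain ⟨hp, -⟩ := Finset.mem_product.1 hph
        obtain ⟨x, hx, hpx⟩ := hA p hp
        have hd := (hpoly p x hx hpx).2 h
        have hs := hd.add hpx
        rcases Multiset.mem_cons.1 hx with rfl | hx'
        · have hgk : IsPM k g := by
            convert hs using 1
            rw [← hgdef]
            funext n
            simp only [Pi.add_apply, Pi.sub_apply]; abel
          by_cases hk : k = 0
          · left; subst hk; exact hgk
          · right
            refine ⟨(k - 1, g), Multiset.mem_add.2 (Or.inr ?_), ?_⟩
            · simp only [N, hk, if_false]
              exact Multiset.mem_map.2 ⟨g, Finset.mem_filter.2 ⟨hg, hgk⟩, rfl⟩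
            · simp only [sub_self]; exact IsPM.zero _
        · right
          refine ⟨(x.1, x.2 - q), Multiset.mem_add.2 (Or.inl
            (Multiset.mem_map.2 ⟨x, hx', rfl⟩)), ?_⟩
          convert hs using 1
          rw [← hgdef]
          funext n
          simp only [Pi.add_apply, Pi.sub_apply]; abel

theorem poly_vdw_s9 {G : Type} [AddCommGroup G] (m : ℕ) (A : Finset (ℕ → G))
    (hA : ∀ p ∈ A, IsPM (m + 1) p) : PGood A := by
  refine good_of_covers _ (A.val.map fun p => (m, p)) A rfl ⟨?_, ?_⟩
  · intro x hx
    obtain ⟨p, hp, rfl⟩ := Multiset.mem_map.1 hx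
    exact hA p hp
  · intro p hp
    right
    exact ⟨(m, p), Multiset.mem_map.2 ⟨p, hp, rfl⟩, by simp only [sub_self]; exact IsPM.zero _⟩

end PolyVdW

theorem mem_newpF_iff (n : ℕ) (𝔛 : Set (Finset (Finset ℕ))) (AB : Finset ℕ × Finset ℕ) :
    AB ∈ newpF n 𝔛 ↔ AB ∈ newp n 𝔛 := by
  classical
  unfold newpF
  rw [Finset.mem_filter]
  refine ⟨fun h => h.2, fun h => ⟨?_, h⟩⟩
  simp only [Finset.mem_product, Finset.mem_powerset]
  exact ⟨h.1, h.2.1⟩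

theorem ratio_scale (d : ℚ) (hd : d ≠ 0) (u : ℕ → ℚ) (AB : Finset ℕ × Finset ℕ)
    (h : AB.2.card ≤ AB.1.card) :
    ratio (fun i => d * u i) AB = d ^ (AB.1.card - AB.2.card) * ratio u AB := by
  unfold ratio
  rw [Finset.prod_mul_distrib, Finset.prod_mul_distrib, Finset.prod_const, Finset.prod_const,
    pow_sub₀ _ hd h, mul_div_mul_comm, div_eq_mul_inv (d ^ _)]

/-- **Shifting lemma.** Let `𝔛` be a collection of new `n`-families with
`|A| > |B|` for all `(A,B) ∈ Ω := newp(𝔛)`.  For every positive integer `r` and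
finite `Ξ ⊆ ℚ_{≥0}^Ω` there are finite sets `D ⊆ ℕ` and `Δ ⊆ ℕ^Ω` such that:
given any `u ∈ ℚ₊^{n-1}`, `x ∈ ℚ₊` and `r`-coloring `C` of `ℚ₊`, there are
`d ∈ D`, `δ ∈ Δ` such that, setting
`x' := x + Σ_{(A,B) ∈ Ω} δ_{(A,B)} (Π_{a∈A} u a)/(Π_{b∈B} u b)` and `u' := d·u`,
we have `C(x' + Σ_{(A,B) ∈ Ω} ξ_{(A,B)} (Π_{a∈A} u' a)/(Π_{b∈B} u' b)) = C(x')`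
for every `ξ ∈ Ξ`. -/
theorem single_shift (n : ℕ) (𝔛 : Set (Finset (Finset ℕ)))
    (h𝔛 : ∀ 𝓘 ∈ 𝔛, IsNFamily n 𝓘 ∧ ∀ F, IsLeading 𝓘 F → n ∈ F)
    (hAB : ∀ AB ∈ newp n 𝔛, AB.2.card < AB.1.card)
    (r : ℕ) (hr : 0 < r)
    (Ξ : Finset ((Finset ℕ × Finset ℕ) → ℚ))
    (hΞ : ∀ ξ ∈ Ξ, ∀ AB ∈ newp n 𝔛, 0 ≤ ξ AB) :
    ∃ (D : Finset ℕ) (Δ : Finset ((Finset ℕ × Finset ℕ) → ℕ)),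
      (∀ d ∈ D, 0 < d) ∧ (∀ δ ∈ Δ, ∀ AB ∈ newp n 𝔛, 0 < δ AB) ∧
      ∀ u : ℕ → ℚ, (∀ i ∈ Finset.Icc 1 (n - 1), 0 < u i) →
      ∀ x : ℚ, 0 < x → ∀ C : ℚ → Fin r,
        ∃ d ∈ D, ∃ δ ∈ Δ,
          ∀ x' : ℚ, x' = x + ∑ AB ∈ newpF n 𝔛, (δ AB : ℚ) * ratio u AB →
          ∀ u' : ℕ → ℚ, u' = (fun i => (d : ℚ) * u i) →
          ∀ ξ ∈ Ξ,
            C (x' + ∑ AB ∈ newpF n 𝔛, ξ AB * ratio u' AB) = C x' := by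
  classical
  set W := newpF n 𝔛 with hW
  have hcard : ∀ AB ∈ W, AB.2.card < AB.1.card := fun AB h => hAB AB ((mem_newpF_iff _ _ _).1 h)
  let e : Finset ℕ × Finset ℕ → ℕ := fun AB => AB.1.card - AB.2.card
  have he : ∀ AB ∈ W, 0 < e AB := fun AB h => Nat.sub_pos_of_lt (hcard AB h)
  obtain ⟨M, hMdef⟩ : ∃ M : ℕ, M = ∏ ξ ∈ Ξ, ∏ AB ∈ W, (ξ AB).den := ⟨_, rfl⟩
  have hM : 0 < M := hMdef ▸ Finset.prod_pos fun ξ _ => Finset.prod_pos fun AB _ => (ξ AB).den_pos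
  have hint : ∀ ξ ∈ Ξ, ∀ AB ∈ W, ∃ c : ℤ, (c : ℚ) = ξ AB * (M : ℚ) ^ e AB := by
    intro ξ hξ AB hABW
    have h0 : (ξ AB).den ∣ ∏ AB ∈ W, (ξ AB).den :=
      Finset.dvd_prod_of_mem (fun AB => (ξ AB).den) hABW
    have h01 : (∏ AB ∈ W, (ξ AB).den) ∣ M := by
      rw [hMdef]
      exact Finset.dvd_prod_of_mem
        (fun ξ : (Finset ℕ × Finset ℕ) → ℚ => ∏ AB ∈ W, (ξ AB).den) hξ
    have h1 : (ξ AB).den ∣ M := h0.trans h01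
    have h2 : (ξ AB).den ∣ M ^ e AB := h1.trans (dvd_pow_self _ (he AB hABW).ne')
    obtain ⟨t, ht⟩ := h2
    refine ⟨(ξ AB).num * t, ?_⟩
    have h3 : (M : ℚ) ^ e AB = (ξ AB).den * t := by exact_mod_cast ht
    rw [h3, ← mul_assoc, Rat.mul_den_eq_num]
    push_cast; ring
  choose! c hc using hint
  let P : ((Finset ℕ × Finset ℕ) → ℚ) → ℕ → (Finset ℕ × Finset ℕ) → ℤ :=
    fun ξ k AB => if AB ∈ W then c ξ AB * (k : ℤ) ^ e AB else 0
  let m : ℕ := W.sup e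
  have hP : ∀ p ∈ Ξ.image P, IsPM (m + 1) p := by
    intro p hp
    obtain ⟨ξ, hξ, rfl⟩ := Finset.mem_image.1 hp
    refine IsPM.pi fun AB => ?_
    by_cases h : AB ∈ W
    · simp only [P, h, if_true]
      have h1 := he AB h
      have h2 : e AB ≤ m := Finset.le_sup h
      have h3 := IsPM.monomial (e AB - 1) (c ξ AB)
      rw [Nat.sub_add_cancel h1] at h3
      exact h3.mono (by omega)
    · simp only [P, h, if_false]
      exact IsPM.zero _
  obtain ⟨S, D, hD, hS⟩ := poly_vdw_s9 m _ hP (Fin r)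
  obtain ⟨K, hKdef⟩ : ∃ K : ℤ, K = 1 + ∑ a ∈ S, ∑ AB ∈ W, |a AB| := ⟨_, rfl⟩
  have hK : ∀ a ∈ S, ∀ AB ∈ W, 0 < a AB + K := by
    intro a ha AB h
    have h1 : |a AB| ≤ ∑ AB ∈ W, |a AB| :=
      Finset.single_le_sum (f := fun AB => |a AB|) (fun _ _ => abs_nonneg _) h
    have h2 : ∑ AB ∈ W, |a AB| ≤ ∑ a ∈ S, ∑ AB ∈ W, |a AB| :=
      Finset.single_le_sum (f := fun a : (Finset ℕ × Finset ℕ) → ℤ => ∑ AB ∈ W, |a AB|)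
        (fun _ _ => Finset.sum_nonneg fun _ _ => abs_nonneg _) ha
    have h3 := neg_abs_le (a AB)
    rw [hKdef]
    linarith
  refine ⟨D.image (fun d => M * d), S.image (fun a AB => (a AB + K).toNat), ?_, ?_, ?_⟩
  · intro d hd
    obtain ⟨d₁, hd₁, rfl⟩ := Finset.mem_image.1 hd
    exact Nat.mul_pos hM (hD d₁ hd₁)
  · intro δ hδ AB h
    obtain ⟨a, ha, rfl⟩ := Finset.mem_image.1 hδ
    have := hK a ha AB ((mem_newpF_iff _ _ _).2 h)
    simpa using this
  · intro u _ x _ C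
    obtain ⟨a, ha, d, hd, h⟩ := hS (fun v => C (x + ∑ AB ∈ W, ((v AB + K : ℤ) : ℚ) * ratio u AB))
    refine ⟨M * d, Finset.mem_image_of_mem _ hd, _, Finset.mem_image_of_mem _ ha, ?_⟩
    rintro x' rfl u' rfl ξ hξ
    have key : ∑ AB ∈ W, (((a AB + K).toNat : ℕ) : ℚ) * ratio u AB
        = ∑ AB ∈ W, ((a AB + K : ℤ) : ℚ) * ratio u AB := by
      refine Finset.sum_congr rfl fun AB hABW => ?_
      have h1 : (((a AB + K).toNat : ℕ) : ℤ) = a AB + K := Int.toNat_of_nonneg (hK a ha AB hABW).le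
      have h2 : (((a AB + K).toNat : ℕ) : ℚ) = ((a AB + K : ℤ) : ℚ) := by
        exact_mod_cast congrArg (fun z : ℤ => (z : ℚ)) h1
      rw [h2]
    rw [key, ← h (P ξ) (Finset.mem_image_of_mem _ hξ)]
    congr 1
    rw [add_assoc, ← Finset.sum_add_distrib]
    congr 1
    refine Finset.sum_congr rfl fun AB hABW => ?_
    have hd0 : ((M * d : ℕ) : ℚ) ≠ 0 := by
      exact_mod_cast (Nat.mul_pos hM (hD d hd)).ne'
    rw [ratio_scale _ hd0 u AB (hcard AB hABW).le]
    have h4 := hc ξ hξ AB hABW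
    simp only [Pi.add_apply, P, hABW, if_true]
    push_cast
    rw [h4, mul_pow]
    simp only [e]
    ring
end
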